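/- Fix an integer d ≥ 3 and a finite set M. For every invariant process X with law in I_d(M), one has Σ_1(X) ≤ Σ_e(X), where Σ_1(X) = H(X_{S_1}) − (d/2) H(X_{E_1}) and Σ_e(X) = (d/2) H(X_{E_1}) − (d−1) H(X_o), with equality if and only if the restriction X_{S_1} of X to the ball S_1 is a vertex-Markov process on S_1. -/

import Mathlib

open MeasureTheory Filter Topology
open scoped ENNReal Classical

noncomputable section

namespace TreeEntropy

@[ext]
structure RCG (M : Type*) where
  col : List ℕ → Option M
  adj : List ℕ × List ℕ → Bool

variable {M : Type*}

def resS (r : ℕ) (g : RCG M) : RCG M where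
  col l := if l.length ≤ r then g.col l else none
  adj p := if p.1.length ≤ r ∧ p.2.length ≤ r then g.adj p else false

def rcgDist (g g' : RCG M) : ℝ :=
  ∑' r : ℕ, if resS r g = resS r g' then 0 else (2:ℝ)⁻¹ ^ r

private lemma rcg_summable (a b : RCG M) : Summable
    (fun r : ℕ => if resS r a = resS r b then (0:ℝ) else (2:ℝ)⁻¹ ^ r) := by
  refine Summable.of_nonneg_of_le (fun r => ?_) (fun r => ?_)
    (summable_geometric_of_lt_one (by norm_num) (by norm_num : (2:ℝ)⁻¹ < 1))
  · split
    · exact le_rfl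
    · positivity
  · split
    · positivity
    · exact le_rfl

private lemma rcg_nonneg (a b : RCG M) (r : ℕ) :
    (0:ℝ) ≤ if resS r a = resS r b then (0:ℝ) else (2:ℝ)⁻¹ ^ r := by
  split
  · exact le_rfl
  · positivity

private lemma rcgDist_self (g : RCG M) : rcgDist g g = 0 := by simp [rcgDist]

private lemma rcgDist_comm (g g' : RCG M) : rcgDist g g' = rcgDist g' g :=
  tsum_congr fun r => if_congr eq_comm rfl rfl

private lemma rcgDist_triangle (g₁ g₂ g₃ : RCG M) :
    rcgDist g₁ g₃ ≤ rcgDist g₁ g₂ + rcgDist g₂ g₃ := by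
  unfold rcgDist
  rw [← Summable.tsum_add (rcg_summable _ _) (rcg_summable _ _)]
  refine Summable.tsum_le_tsum (fun r => ?_) (rcg_summable _ _)
    ((rcg_summable _ _).add (rcg_summable _ _))
  have hx : (0:ℝ) ≤ (2:ℝ)⁻¹ ^ r := by positivity
  by_cases h12 : resS r g₁ = resS r g₂
  · by_cases h23 : resS r g₂ = resS r g₃
    · rw [if_pos h12, if_pos h23, if_pos (h12.trans h23)]; linarith
    · rw [if_pos h12, if_neg h23, zero_add]
      split_ifs <;> linarith
  · by_cases h23 : resS r g₂ = resS r g₃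
    · rw [if_neg h12, if_pos h23, add_zero]
      split_ifs <;> linarith
    · rw [if_neg h12, if_neg h23]
      split_ifs <;> linarith

private lemma rcgDist_eq_zero (g g' : RCG M) (h : rcgDist g g' = 0) : g = g' := by
  unfold rcgDist at h
  have hr : ∀ r : ℕ, resS r g = resS r g' := by
    intro r
    by_contra hne
    have hpos : (0:ℝ) <
        ∑' r : ℕ, if resS r g = resS r g' then (0:ℝ) else (2:ℝ)⁻¹ ^ r :=
      Summable.tsum_pos (rcg_summable g g') (rcg_nonneg g g') r
        (by rw [if_neg hne]; positivity)
    exact absurd h hpos.ne'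
  have hc : g.col = g'.col := by
    funext l
    have h1 := congrFun (congrArg RCG.col (hr l.length)) l
    simpa [resS] using h1
  have ha : g.adj = g'.adj := by
    funext p
    have h1 := congrFun (congrArg RCG.adj (hr (max p.1.length p.2.length))) p
    simpa [resS, le_max_left, le_max_right] using h1
  exact RCG.ext hc ha

instance : MetricSpace (RCG M) where
  dist := rcgDist
  dist_self := rcgDist_self
  dist_comm := rcgDist_comm
  dist_triangle := rcgDist_triangle
  eq_of_dist_eq_zero := rcgDist_eq_zero _ _

instance : MeasurableSpace (RCG M) := borel _
instance : BorelSpace (RCG M) := ⟨rfl⟩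


/-! ### The `d`-regular tree `T_d` -/

/-- A list `l = [i_k, …, i_1]` (deepest step first) is the breadth-first-search label of a
vertex of the `d`-regular tree `T_d` iff its first (root-side) step lies in `{1, …, d}` and all
subsequent steps lie in `{1, …, d-1}`. -/
def ValidTd (d : ℕ) (l : List ℕ) : Prop :=
  (∀ i ∈ l.dropLast, 1 ≤ i ∧ i ≤ d - 1) ∧ (∀ i ∈ l.getLast?, 1 ≤ i ∧ i ≤ d)

/-- The vertex set of the `d`-regular tree `T_d`. -/
def TdVertex (d : ℕ) : Type := {l : List ℕ // ValidTd d l}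

/-- The root `o` of `T_d`. -/
def rootTd (d : ℕ) : TdVertex d := ⟨[], by constructor <;> simp [List.getLast?]⟩

/-- The first neighbor `1` of the root of `T_d` (defined as the root for the degenerate case
`d = 0`, which never occurs below). -/
def node1 (d : ℕ) : TdVertex d :=
  if h : 1 ≤ d then ⟨[1], by constructor <;> simp [List.getLast?, h]⟩ else rootTd d

/-- The graph structure of the `d`-regular tree: two vertices are adjacent iff one is obtained
from the other by adding one step. -/
def TdGraph (d : ℕ) : SimpleGraph (TdVertex d) where
  Adj v w := (∃ i, w.1 = i :: v.1) ∨ (∃ i, v.1 = i :: w.1)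
  symm := ⟨by intro v w h; tauto⟩
  loopless := by
    refine ⟨?_⟩
    rintro v (⟨i, h⟩ | ⟨i, h⟩) <;>
      · have := congrArg List.length h
        simp at this

/-- Graph distance between two vertices of a tree encoded by their BFS labels: the nearest
common ancestor corresponds to the longest common suffix. -/
def treeDist (u w : List ℕ) : ℕ :=
  ((u.reverse.zip w.reverse).takeWhile (fun p => p.1 = p.2)).length |> fun c =>
    (u.length - c) + (w.length - c)

/-- The ball `S_r = B_r(o)` of radius `r` around the root of `T_d`. -/
def SrSet (d r : ℕ) : Set (TdVertex d) := {v | v.1.length ≤ r}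

/-- The set `E_r = B_{r-1}({o,1})` of vertices at distance at most `r-1` from the edge `{o,1}`
of `T_d` (for `r ≥ 1`). -/
def ErSet (d r : ℕ) : Set (TdVertex d) :=
  {v | v.1.length + 1 ≤ r ∨ (v.1.getLast? = some 1 ∧ v.1.length ≤ r)}

lemma ErSet_subset_SrSet (d r : ℕ) : ErSet d r ⊆ SrSet d r := by
  rintro v (h | ⟨-, h⟩) <;> simp only [SrSet, Set.mem_setOf_eq] <;> omega

/-! ### Invariant processes on `T_d` and their entropies -/

variable (d : ℕ) (M : Type*)

/-- `I_d(M)`: the set of probability measures on `M^{T_d}` invariant under all automorphisms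
of the tree `T_d`. -/
def InvMeas [MeasurableSpace M] : Set (Measure (TdVertex d → M)) :=
  {μ | IsProbabilityMeasure μ ∧
    ∀ φ : TdGraph d ≃g TdGraph d, μ.map (fun x => fun v => x (φ v)) = μ}

variable {d M}

/-- The Shannon entropy of (the distribution of) a random variable with law `μ`, a measure
with countable support on a discrete space. -/
def shannon {α : Type*} [MeasurableSpace α] (μ : Measure α) : ℝ :=
  ∑' a : α, Real.negMulLog (μ {a}).toReal

/-- The restriction `X_S` of a process `X` on `T_d` to a subset `S` of the vertices:
the pushforward of its law. -/
def restrictTo [MeasurableSpace M] (S : Set (TdVertex d))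
    (μ : Measure (TdVertex d → M)) : Measure (↥S → M) :=
  μ.map (fun x => fun v => x v.1)

/-- The annealed entropy `Σ_r(μ) = H(X_{S_r}) - (d/2) H(X_{E_r})`. -/
def SigmaR [MeasurableSpace M] (d : ℕ) (r : ℕ) (μ : Measure (TdVertex d → M)) : ℝ :=
  shannon (restrictTo (SrSet d r) μ) - (d / 2 : ℝ) * shannon (restrictTo (ErSet d r) μ)

/-- The annealed entropy `Σ(μ) = lim_r Σ_r(μ)`: the limit of the non-increasing sequence
`r ↦ Σ_r(μ)` (`r ≥ 1`), as an extended real (the limit may be `-∞`). -/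
def SigmaInf [MeasurableSpace M] (d : ℕ) (μ : Measure (TdVertex d → M)) : EReal :=
  ⨅ r : ℕ, ((SigmaR d (r + 1) μ : ℝ) : EReal)

/-- `Σ_e(X) = (d/2) H(X_{E_1}) - (d-1) H(X_o)`. -/
def SigmaE [MeasurableSpace M] (d : ℕ) (μ : Measure (TdVertex d → M)) : ℝ :=
  (d / 2 : ℝ) * shannon (restrictTo (ErSet d 1) μ)
    - ((d : ℝ) - 1) * shannon (restrictTo ({rootTd d} : Set (TdVertex d)) μ)

/-! ### Markov processes on `T_d` -/

/-- The elementary cylinder event: the coloring takes the values prescribed by `y` on `S`. -/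
def cylEvent (S : Set (TdVertex d)) (y : TdVertex d → M) : Set (TdVertex d → M) :=
  {x | ∀ v ∈ S, x v = y v}

/-- The side of the edge `{u,w}` containing `u`, in the tree `T_d`. -/
def sideOf (u w : TdVertex d) : Set (TdVertex d) :=
  {v | treeDist v.1 u.1 < treeDist v.1 w.1}

/-- `B_{r-1}({u,w})`: the set of vertices at distance at most `r-1` from the edge `{u,w}`. -/
def edgeBall (r : ℕ) (u w : TdVertex d) : Set (TdVertex d) :=
  {v | treeDist v.1 u.1 + 1 ≤ r ∨ treeDist v.1 w.1 + 1 ≤ r}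

/-- A probability measure on `M^{T_d}` is `r`-Markov on a subset `A` of `T_d` if, for every
edge `{u,w}` of `A`, conditioned on the value on the `(r-1)`-neighborhood of the edge
(within `A`), the processes on the two sides of the edge (within `A`) are independent;
equivalently, the corresponding products of cylinder probabilities agree.  For `A` the whole
tree and `r = 1` this is the edge-Markov property. -/
def rMarkovOn [MeasurableSpace M] (r : ℕ) (A : Set (TdVertex d))
    (μ : Measure (TdVertex d → M)) : Prop :=
  ∀ u w : TdVertex d, u ∈ A → w ∈ A → (TdGraph d).Adj u w →
    ∀ F₁ F₂ : Finset (TdVertex d), ↑F₁ ⊆ sideOf u w ∩ A → ↑F₂ ⊆ sideOf w u ∩ A →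
      ∀ y : TdVertex d → M,
        μ (cylEvent (↑F₁ ∪ ↑F₂ ∪ (edgeBall r u w ∩ A)) y)
            * μ (cylEvent (edgeBall r u w ∩ A) y)
          = μ (cylEvent (↑F₁ ∪ (edgeBall r u w ∩ A)) y)
            * μ (cylEvent (↑F₂ ∪ (edgeBall r u w ∩ A)) y)

/-- A probability measure on `M^{T_d}` is `r`-Markov if, conditioned on the value on the
`(r-1)`-neighborhood of any edge, the processes on the two sides of the edge are
independent. -/
def rMarkov [MeasurableSpace M] (r : ℕ) (μ : Measure (TdVertex d → M)) : Prop :=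
  rMarkovOn r Set.univ μ

/-- A probability measure on `M^{T_d}` is vertex-Markov if, conditioned on the value at a
vertex, the processes on the pending subtrees of that vertex are independent. -/
def vertexMarkov [MeasurableSpace M] (μ : Measure (TdVertex d → M)) : Prop :=
  ∀ v : TdVertex d, ∀ k : ℕ, ∀ u : Fin k → TdVertex d,
    Function.Injective u → (∀ i, (TdGraph d).Adj v (u i)) →
    ∀ F : Fin k → Finset (TdVertex d), (∀ i, ↑(F i) ⊆ sideOf (u i) v) →
      ∀ y : TdVertex d → M,
        μ (cylEvent ((⋃ i, ↑(F i)) ∪ {v}) y) * (μ (cylEvent {v} y)) ^ (k - 1)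
          = ∏ i : Fin k, μ (cylEvent (↑(F i) ∪ {v}) y)

/-- `X_{S_1}` is a vertex-Markov process on `S_1`: the values at the `d` neighbors of the
root are conditionally independent given the value at the root. -/
def vertexMarkovOnS1 [MeasurableSpace M] (d : ℕ) (μ : Measure (TdVertex d → M)) : Prop :=
  ∀ y : TdVertex d → M,
    μ (cylEvent (SrSet d 1) y) * (μ (cylEvent ({rootTd d} : Set (TdVertex d)) y)) ^ (d - 1)
      = ∏ i ∈ Finset.Icc 1 d,
          μ (cylEvent {v : TdVertex d | v = rootTd d ∨ v.1 = [i]} y)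


/-! ### The randomly labeled rooted colored graph associated to a finite colored graph

Given a finite colored graph `(G,f)` and a vertex `v`, the associated randomly labeled rooted
colored graph is obtained by a breadth-first search exploration of the connected component of
`v` started at `v`, ties between vertices being broken uniformly at random.  We implement the
uniformly random tie-breaking by a uniformly random priority permutation `σ`. -/

variable {M : Type*} {n : ℕ}

/-- The `k`-th layer of the breadth-first search of `G` started at `v`, ordered according to
the position of the parents in the previous layer, ties being broken by the priority `σ`. -/
def bfsLayer (G : SimpleGraph (Fin n)) (v : Fin n) (σ : Equiv.Perm (Fin n)) :
    ℕ → List (Fin n)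
  | 0 => [v]
  | (k + 1) =>
    let prev := bfsLayer G v σ k
    let key : Fin n → ℕ := fun w =>
      (prev.idxOf (((prev.find? (fun u => decide (G.Adj u w))).getD v))) * n + (σ w : ℕ)
    ((List.finRange n).filter
        (fun w => decide (G.Reachable v w ∧ G.dist v w = k + 1))).mergeSort
      (fun a b => key a ≤ key b)

/-- The breadth-first-search label of the vertex `w` lying in layer `k` of the exploration of
`G` started at `v` with tie-breaking priority `σ`. -/
def bfsPathAux (G : SimpleGraph (Fin n)) (v : Fin n) (σ : Equiv.Perm (Fin n)) :
    ℕ → Fin n → Option (List ℕ)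
  | 0, w => if w = v then some [] else none
  | (k + 1), w =>
    match (bfsLayer G v σ k).find? (fun u => decide (G.Adj u w)) with
    | none => none
    | some p =>
      let L := bfsLayer G v σ (k + 1)
      let j := 1 + ((L.takeWhile (fun w' => w' ≠ w)).filter
        (fun w' => (bfsLayer G v σ k).find? (fun u => decide (G.Adj u w')) = some p)).length
      (bfsPathAux G v σ k p).map (fun pl => j :: pl)

/-- The breadth-first-search label of the vertex `w` in the exploration of the connected
component of `v` in `G`, with tie-breaking priority `σ` (`none` if `w` is not in the component
of `v`). -/
def bfsPath (G : SimpleGraph (Fin n)) (v : Fin n) (σ : Equiv.Perm (Fin n)) (w : Fin n) :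
    Option (List ℕ) :=
  if G.Reachable v w then bfsPathAux G v σ (G.dist v w) w else none

/-- The rooted colored graph obtained from the colored graph `(G,f)` by the breadth-first
search exploration of the connected component of `v` rooted at `v`, with tie-breaking
priority `σ`. -/
def bfsRCG (G : SimpleGraph (Fin n)) (f : Fin n → M) (v : Fin n) (σ : Equiv.Perm (Fin n)) :
    RCG M where
  col l := if h : ∃ w, bfsPath G v σ w = some l then some (f h.choose) else none
  adj p :=
    if (∃ w₁ w₂, bfsPath G v σ w₁ = some p.1 ∧ bfsPath G v σ w₂ = some p.2 ∧ G.Adj w₁ w₂)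
    then true else false

/-- `distr_{G,v}(f)`: the law of the randomly labeled rooted colored graph obtained from the
connected component of `v` in the colored graph `(G,f)`, rooted at `v`. -/
def distrAt (G : SimpleGraph (Fin n)) (f : Fin n → M) (v : Fin n) : Measure (RCG M) :=
  ((Nat.factorial n : ℝ≥0∞))⁻¹ •
    ∑ σ : Equiv.Perm (Fin n), Measure.dirac (bfsRCG G f v σ)

/-- `distr_G(f) = (1/|V|) ∑_{v ∈ V} distr_{G,v}(f)`. -/
def distrG (G : SimpleGraph (Fin n)) (f : Fin n → M) : Measure (RCG M) :=
  ((n : ℝ≥0∞))⁻¹ • ∑ v : Fin n, distrAt G f v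

/-! ### Random regular graphs -/

/-- The set `𝓖_n(d)` of simple `d`-regular graphs on the vertex set `{1, …, n}`. -/
def regularGraphs (d n : ℕ) : Set (SimpleGraph (Fin n)) :=
  {G | ∀ v, (G.neighborSet v).ncard = d}

/-- The probability that a uniformly distributed random `d`-regular graph `G_n` on `n`
vertices belongs to `A`. -/
def PrG (d n : ℕ) (A : Set (SimpleGraph (Fin n))) : ℝ :=
  ((regularGraphs d n ∩ A).ncard : ℝ) / ((regularGraphs d n).ncard : ℝ)

/-- The expectation of `F(G_n)` for a uniformly distributed random `d`-regular graph `G_n`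
on `n` vertices. -/
def ExG (d n : ℕ) (F : SimpleGraph (Fin n) → ℝ) : ℝ :=
  (∑ᶠ G ∈ regularGraphs d n, F G) / ((regularGraphs d n).ncard : ℝ)

/-- The integers `n` for which the set of simple `d`-regular graphs on `n` vertices is
non-empty: `n ≥ d + 1` and `nd` even.  Limits `n → ∞` are taken along this set. -/
def goodN (d : ℕ) : Set ℕ := {n | d + 1 ≤ n ∧ Even (n * d)}

/-- The filter `n → ∞` along `{n : n ≥ d+1, nd even}`. -/
def goodFilter (d : ℕ) : Filter ℕ := Filter.atTop ⊓ Filter.principal (goodN d)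

/-! ### The embedding of invariant processes into rooted colored graphs -/

/-- The rooted colored graph `(T_d, x, o)` associated to a coloring `x` of `T_d` (the
canonical labeling of `T_d` is a breadth-first-search labeling; for an invariant process the
resulting law is that of the randomly labeled rooted colored graph). -/
def iotaTd (d : ℕ) (x : TdVertex d → M) : RCG M where
  col l := if h : ValidTd d l then some (x ⟨l, h⟩) else none
  adj p :=
    if (ValidTd d p.1 ∧ ValidTd d p.2 ∧ ((∃ i, p.2 = i :: p.1) ∨ (∃ i, p.1 = i :: p.2)))
    then true else false

/-- The law, as a probability measure on rooted colored graphs, of the randomly labeled rooted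
colored tree `(T_d, X, o)` where `X` has law `μ`. -/
def lawTd (d : ℕ) [MeasurableSpace M] (μ : Measure (TdVertex d → M)) : Measure (RCG M) :=
  μ.map (iotaTd d)

/-! ### Micro-state (sofic) entropy -/

/-- `𝓕_G(μ,r,ε)`: the set of colorings `f` of `G` whose radius-`r` local statistics are
`ε`-close (in the Lévy-Prokhorov distance, which generates the weak topology) to the
radius-`r` restriction of `μ`. -/
def FSet (d : ℕ) [MeasurableSpace M] (μ : Measure (TdVertex d → M)) (r : ℕ) (ε : ℝ)
    (G : SimpleGraph (Fin n)) : Set (Fin n → M) :=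
  {f | levyProkhorovDist ((distrG G f).map (resS r)) ((lawTd d μ).map (resS r)) ≤ ε}

/-- `H_{G}(μ,r,ε) = (1/n) log |𝓕_G(μ,r,ε)| ∈ {-∞} ∪ [0,∞)`. -/
def HG (d : ℕ) [MeasurableSpace M] (μ : Measure (TdVertex d → M)) (r : ℕ) (ε : ℝ)
    (G : SimpleGraph (Fin n)) : EReal :=
  if FSet d μ r ε G = ∅ then ⊥
  else ((Real.log ((FSet d μ r ε G).ncard) / n : ℝ) : EReal)

/-- `h_n(μ,r,ε,α)`: the `α`-quantile
`sup { h ∈ {-∞} ∪ [0,∞) : ℙ(H_{G_n}(μ,r,ε) ≥ h) ≥ α }`. -/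
def hquant (d : ℕ) [MeasurableSpace M] (μ : Measure (TdVertex d → M)) (r : ℕ) (ε : ℝ)
    (α : ℝ) (n : ℕ) : EReal :=
  sSup {h : EReal | (h = ⊥ ∨ 0 ≤ h) ∧
    α ≤ PrG d n {G : SimpleGraph (Fin n) | h ≤ HG d μ r ε G}}

/-- The upper entropy `h̄(μ,r,α) = lim_{ε → 0} limsup_n h_n(μ,r,ε,α)` (the limit over `ε`
of a quantity non-decreasing in `ε`, i.e. the infimum over `ε > 0`). -/
def hbarA (d : ℕ) [MeasurableSpace M] (μ : Measure (TdVertex d → M)) (r : ℕ) (α : ℝ) :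
    EReal :=
  ⨅ ε : {e : ℝ // 0 < e}, (goodFilter d).limsup (fun n => hquant d μ r ε.1 α n)

/-- The lower entropy `h̲(μ,r,α) = lim_{ε → 0} liminf_n h_n(μ,r,ε,α)`. -/
def hlowA (d : ℕ) [MeasurableSpace M] (μ : Measure (TdVertex d → M)) (r : ℕ) (α : ℝ) :
    EReal :=
  ⨅ ε : {e : ℝ // 0 < e}, (goodFilter d).liminf (fun n => hquant d μ r ε.1 α n)

/-- `h̄(μ,r)`: the common value of `h̄(μ,r,α)`, `0 < α < 1`. -/
def hbarR (d : ℕ) [MeasurableSpace M] (μ : Measure (TdVertex d → M)) (r : ℕ) : EReal :=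
  hbarA d μ r (1 / 2)

/-- `h̲(μ,r)`: the common value of `h̲(μ,r,α)`, `0 < α < 1`. -/
def hlowR (d : ℕ) [MeasurableSpace M] (μ : Measure (TdVertex d → M)) (r : ℕ) : EReal :=
  hlowA d μ r (1 / 2)

/-- The upper sofic entropy `h̄(μ) = lim_{r → ∞} h̄(μ,r)` (the limit of a non-increasing
sequence, i.e. the infimum over `r`). -/
def hbar (d : ℕ) [MeasurableSpace M] (μ : Measure (TdVertex d → M)) : EReal :=
  ⨅ r : ℕ, hbarR d μ r

/-- The lower sofic entropy `h̲(μ) = lim_{r → ∞} h̲(μ,r)`. -/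
def hlow (d : ℕ) [MeasurableSpace M] (μ : Measure (TdVertex d → M)) : EReal :=
  ⨅ r : ℕ, hlowR d μ r

/-! ### Typical processes -/

/-- The probability that the random `d`-regular graph `G_n` admits a coloring whose local
statistics are `ε`-close to `μ`. -/
def typicalPr (d : ℕ) [MeasurableSpace M] (μ : Measure (TdVertex d → M)) (ε : ℝ) (n : ℕ) :
    ℝ :=
  PrG d n {G : SimpleGraph (Fin n) |
    ∃ f : Fin n → M, levyProkhorovDist (distrG G f) (lawTd d μ) ≤ ε}

/-- `μ ∈ I_d(M)` is weakly typical if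
`lim_{ε → 0} limsup_{n → ∞} ℙ(∃ f : d(distr_{G_n}(f), μ) ≤ ε) = 1`. -/
def WeaklyTypical (d : ℕ) [MeasurableSpace M] (μ : Measure (TdVertex d → M)) : Prop :=
  Tendsto (fun ε => (goodFilter d).limsup (fun n => typicalPr d μ ε n))
    (nhdsWithin 0 (Set.Ioi 0)) (nhds 1)

/-- `μ ∈ I_d(M)` is strongly typical if
`lim_{ε → 0} lim_{n → ∞} ℙ(∃ f : d(distr_{G_n}(f), μ) ≤ ε) = 1` (in particular the inner
limits along `n → ∞` exist). -/
def StronglyTypical (d : ℕ) [MeasurableSpace M] (μ : Measure (TdVertex d → M)) : Prop :=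
  ∃ L : ℝ → ℝ,
    (∀ ε : ℝ, 0 < ε → Tendsto (fun n => typicalPr d μ ε n) (goodFilter d) (nhds (L ε))) ∧
    Tendsto L (nhdsWithin 0 (Set.Ioi 0)) (nhds 1)


/-! ### Processes on balls of `T_d` and the sets `I_{d,r}(M)`, `I_e(M)` -/

/-- The ball `S_r` of `T_d` as an induced subgraph. -/
def SrGraph (d r : ℕ) : SimpleGraph ↥(SrSet d r) := (TdGraph d).induce (SrSet d r)

/-- The set `E_r` of `T_d` as an induced subgraph. -/
def ErGraph (d r : ℕ) : SimpleGraph ↥(ErSet d r) := (TdGraph d).induce (ErSet d r)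

lemma root_mem_Er (d r : ℕ) (hr : 1 ≤ r) : rootTd d ∈ ErSet d r := by
  left; simpa [rootTd] using hr

lemma node1_mem_Er (d r : ℕ) (hr : 1 ≤ r) : node1 d ∈ ErSet d r := by
  by_cases h : 1 ≤ d
  · right
    constructor <;> simp [node1, h, List.getLast?, hr]
  · simpa [node1, h] using root_mem_Er d r hr

variable {M : Type*}

/-- The restriction to `E_r ⊆ S_r` of a probability measure on `M^{S_r}`. -/
def restrictErOfSr [MeasurableSpace M] (d r : ℕ) (p : Measure (↥(SrSet d r) → M)) :
    Measure (↥(ErSet d r) → M) :=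
  p.map (fun x => fun v : ↥(ErSet d r) => x ⟨v.1, ErSet_subset_SrSet d r v.2⟩)

/-- `I_{d,r}(M)`: the set of probability measures on `M^{S_r}` which are invariant under the
automorphisms of `S_r` and whose restriction to `E_r` is invariant under switching the two
sides of the edge `{o,1}`. -/
def IdrMeas (d r : ℕ) (M : Type*) [MeasurableSpace M] :
    Set (Measure (↥(SrSet d r) → M)) :=
  {p | IsProbabilityMeasure p ∧
    (∀ φ : SrGraph d r ≃g SrGraph d r, p.map (fun x => fun v => x (φ v)) = p) ∧
    (∀ ψ : ErGraph d r ≃g ErGraph d r,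
      (∀ hv : rootTd d ∈ ErSet d r, ((ψ ⟨rootTd d, hv⟩ : ↥(ErSet d r)) : TdVertex d) = node1 d) →
      (restrictErOfSr d r p).map (fun x => fun v => x (ψ v)) = restrictErOfSr d r p)}

/-- The annealed entropy `Σ(p) = H(X_{S_r}) - (d/2) H(X_{E_r})` of `p ∈ I_{d,r}(M)`. -/
def SigmaP [MeasurableSpace M] (d r : ℕ) (p : Measure (↥(SrSet d r) → M)) : ℝ :=
  shannon p - (d / 2 : ℝ) * shannon (restrictErOfSr d r p)

/-- The involution of `E_1 = {o, 1}` switching the two sides of the edge `{o,1}`. -/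
def swapE1 (d : ℕ) : ↥(ErSet d 1) → ↥(ErSet d 1) := fun v =>
  if (v : TdVertex d) = rootTd d then ⟨node1 d, node1_mem_Er d 1 le_rfl⟩
  else ⟨rootTd d, root_mem_Er d 1 le_rfl⟩

/-- `I_e(M)`: the set of probability measures on `M^{E_1}` invariant under switching the two
sides of the edge `{o,1}`. -/
def IeMeas (d : ℕ) (M : Type*) [MeasurableSpace M] : Set (Measure (↥(ErSet d 1) → M)) :=
  {p | IsProbabilityMeasure p ∧ p.map (fun x => fun v => x (swapE1 d v)) = p}

/-- The annealed entropy `Σ(p) = (d/2) H(X_{E_1}) - (d-1) H(X_o)` of `p ∈ I_e(M)`. -/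
def SigmaPe [MeasurableSpace M] (d : ℕ) (p : Measure (↥(ErSet d 1) → M)) : ℝ :=
  (d / 2 : ℝ) * shannon p
    - ((d : ℝ) - 1) * shannon (p.map (fun x => x ⟨rootTd d, root_mem_Er d 1 le_rfl⟩))

/-! ### Factor graphs: functions of rooted unlabeled colored graphs of radius `r` -/

/-- The vertex set of a rooted colored graph. -/
def vertsOf (g : RCG M) : Set (List ℕ) := {l | g.col l ≠ none}

/-- An isomorphism of rooted colored graphs (a color- and adjacency-preserving bijection of
the vertex sets mapping root to root). -/
def RCGRootedIso (g g' : RCG M) : Prop :=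
  ∃ e : ↥(vertsOf g) ≃ ↥(vertsOf g'),
    (∀ v, g'.col ((e v) : List ℕ) = g.col (v : List ℕ)) ∧
    (∀ v w, g'.adj (((e v) : List ℕ), ((e w) : List ℕ)) = g.adj ((v : List ℕ), (w : List ℕ))) ∧
    (∀ h : [] ∈ vertsOf g, ∀ _ : [] ∈ vertsOf g', ((e ⟨[], h⟩) : List ℕ) = [])

/-- A function on rooted unlabeled colored graphs of radius `r`: a function of rooted colored
graphs which only depends on the isomorphism class of the ball of radius `r` around the
root. -/
def IsRadiusRFn (r : ℕ) (ψ : RCG M → ℝ) : Prop :=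
  ∀ g g' : RCG M, RCGRootedIso (resS r g) (resS r g') → ψ g = ψ g'

/-- The value `ψ((G,f,v)_r)` of `ψ` at the rooted unlabeled colored graph given by the ball of
radius `r` around `v` in `(G,f)` (computed as the average over the random labelings, which is
the constant value of `ψ` on them when `ψ` is a function of the unlabeled graph). -/
def psiAt {n : ℕ} (G : SimpleGraph (Fin n)) (f : Fin n → M) (v : Fin n) (ψ : RCG M → ℝ) :
    ℝ :=
  ∫ g, ψ g ∂(distrAt G f v)

/-- The partition function `Z_G = ∑_f ∏_v exp(ψ((G,f,v)_r))` of the factor model `ψ`. -/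
def ZG {n : ℕ} [Fintype M] (G : SimpleGraph (Fin n)) (ψ : RCG M → ℝ) : ℝ :=
  ∑ f : Fin n → M, Real.exp (∑ v : Fin n, psiAt G f v ψ)

/-- The ground-state energy `L_G = max_f ∑_v ψ((G,f,v)_r)`. -/
def LG {n : ℕ} (G : SimpleGraph (Fin n)) (ψ : RCG M → ℝ) : ℝ :=
  sSup {x : ℝ | ∃ f : Fin n → M, x = ∑ v : Fin n, psiAt G f v ψ}

/-- The canonical rooted colored graph associated to a coloring of the ball `S_r` of `T_d`. -/
def iotaSr (d r : ℕ) (x : ↥(SrSet d r) → M) : RCG M where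
  col l := if h : ValidTd d l ∧ l.length ≤ r then some (x ⟨⟨l, h.1⟩, h.2⟩) else none
  adj p := if (ValidTd d p.1 ∧ ValidTd d p.2 ∧ p.1.length ≤ r ∧ p.2.length ≤ r ∧
      ((∃ i, p.2 = i :: p.1) ∨ (∃ i, p.1 = i :: p.2))) then true else false

/-- `⟨p, ψ⟩ = E[ψ(X)]` where `X` has law `p ∈ I_{d,r}(M)`. -/
def pairing [MeasurableSpace M] (d r : ℕ) (p : Measure (↥(SrSet d r) → M))
    (ψ : RCG M → ℝ) : ℝ :=
  ∫ x, ψ (iotaSr d r x) ∂p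

/-! ### Annealed quantities for random regular graphs -/

/-- `log` with the convention `log 0 = -∞`, with values in the extended reals. -/
def elog (x : ℝ) : EReal := if x ≤ 0 then ⊥ else ((Real.log x : ℝ) : EReal)

/-- The set `𝓖_n(μ,r,ε)` of pairs `(G,f)` of a `d`-regular graph together with a coloring
whose radius-`r` local statistics are `ε`-close to `μ_r`. -/
def GnPairs (d : ℕ) [MeasurableSpace M] (μ : Measure (TdVertex d → M)) (r : ℕ) (ε : ℝ)
    (n : ℕ) : Set (SimpleGraph (Fin n) × (Fin n → M)) :=
  {Gf | Gf.1 ∈ regularGraphs d n ∧ Gf.2 ∈ FSet d μ r ε Gf.1}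

/-- The annealed entropy
`Σ_n(μ,r,ε) = (1/n) (log |𝓖_n(μ,r,ε)| - log |𝓖_n(d)|) = (1/n) log E |𝓕_{G_n}(μ,r,ε)|`. -/
def SigmaN (d : ℕ) [MeasurableSpace M] (μ : Measure (TdVertex d → M)) (r : ℕ) (ε : ℝ)
    (n : ℕ) : EReal :=
  (((n : ℝ)⁻¹ : ℝ) : EReal) *
    elog (((GnPairs d μ r ε n).ncard : ℝ) / ((regularGraphs d n).ncard : ℝ))

/-- The relaxed partition function `Z_G(β) = ∑_f exp(-nβ d(distr_G(f)_r, μ_r))`. -/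
def ZGbeta (d : ℕ) [MeasurableSpace M] {n : ℕ} [Fintype M] (μ : Measure (TdVertex d → M))
    (r : ℕ) (β : ℝ) (G : SimpleGraph (Fin n)) : ℝ :=
  ∑ f : Fin n → M, Real.exp (-(n : ℝ) * β *
    levyProkhorovDist ((distrG G f).map (resS r)) ((lawTd d μ).map (resS r)))


/-! ### Processes on unimodular Galton-Watson trees

A colored rooted tree `(T, X, o)` with `T` a subtree of the label set, rooted at `[]` and
with the children of a vertex `v` labeled `1 :: v, …, N_v :: v`, is encoded as a rooted
colored graph in `RCG M`. -/

/-- `g` is a canonically labeled colored rooted tree. -/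
def IsCanonTree (g : RCG M) : Prop :=
  g.col [] ≠ none ∧
  (∀ l : List ℕ, g.col l ≠ none → g.col l.tail ≠ none) ∧
  (∀ (v : List ℕ) (i : ℕ), 1 ≤ i → g.col ((i + 1) :: v) ≠ none → g.col (i :: v) ≠ none) ∧
  (∀ v : List ℕ, g.col (0 :: v) = none) ∧
  (∀ p : List ℕ × List ℕ, g.adj p = true ↔
    (g.col p.1 ≠ none ∧ g.col p.2 ≠ none ∧
      ((∃ i, p.2 = i :: p.1) ∨ (∃ i, p.1 = i :: p.2))))

/-- A finite canonically labeled tree. -/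
def IsFinTree (t : Finset (List ℕ)) : Prop :=
  [] ∈ t ∧ (∀ l ∈ t, l.tail ∈ t) ∧
  (∀ (v : List ℕ) (i : ℕ), 1 ≤ i → ((i + 1) :: v) ∈ t → (i :: v) ∈ t) ∧
  (∀ v : List ℕ, (0 :: v) ∉ t)

/-- The number of children of the vertex `v` in the finite tree `t`. -/
def childCountF (t : Finset (List ℕ)) (v : List ℕ) : ℕ :=
  (t.filter (fun w => w ≠ [] ∧ w.tail = v)).card

/-- The size-biased version `π̂(k) = (k+1) π(k+1) / d` of the offspring distribution `π`. -/
def sizeBiased (π : ℕ → ℝ) (dd : ℝ) (k : ℕ) : ℝ := (k + 1 : ℝ) * π (k + 1) / dd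

/-- The probability that the unimodular Galton-Watson tree with degree distribution `π`,
truncated at depth `k`, equals the finite tree `t`. -/
def treeWeight (π : ℕ → ℝ) (dd : ℝ) (k : ℕ) (t : Finset (List ℕ)) : ℝ :=
  π (childCountF t []) *
    ∏ v ∈ t.filter (fun v => v ≠ [] ∧ v.length < k), sizeBiased π dd (childCountF t v)

/-- The law of the underlying tree is the unimodular Galton-Watson law `UGW(π)`:
all finite-depth truncations have the prescribed distribution. -/
def IsUGWTreeLaw (π : ℕ → ℝ) (dd : ℝ) (μ : Measure (RCG M)) : Prop :=
  ∀ (k : ℕ) (t : Finset (List ℕ)), IsFinTree t → (∀ v ∈ t, v.length ≤ k) →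
    (μ {g | ∀ l : List ℕ, l.length ≤ k → (g.col l ≠ none ↔ l ∈ t)}).toReal
      = treeWeight π dd k t

/-- `e` realizes an isomorphism (not necessarily root-preserving) of the colored graphs `g`
and `g'`. -/
def IsIsoVia (g g' : RCG M) (e : List ℕ → List ℕ) : Prop :=
  Set.BijOn e (vertsOf g) (vertsOf g') ∧
  (∀ l ∈ vertsOf g, g'.col (e l) = g.col l) ∧
  (∀ l ∈ vertsOf g, ∀ l' ∈ vertsOf g, g'.adj (e l, e l') = g.adj (l, l'))

/-- A function on doubly rooted colored graphs, invariant under isomorphisms. -/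
def PairInvariant (F : RCG M → List ℕ → List ℕ → ℝ≥0∞) : Prop :=
  ∀ g g' e, IsIsoVia g g' e → ∀ u ∈ vertsOf g, ∀ v ∈ vertsOf g, F g' (e u) (e v) = F g u v

/-- Unimodularity (the mass-transport principle):
`E ∑_v F(G,o,v) = E ∑_v F(G,v,o)` for all isomorphism-invariant `F ≥ 0`. -/
def Unimodular (μ : Measure (RCG M)) : Prop :=
  ∀ F : RCG M → List ℕ → List ℕ → ℝ≥0∞, PairInvariant F →
    ∫⁻ g, (∑' v : ↥(vertsOf g), F g [] (v : List ℕ)) ∂μ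
      = ∫⁻ g, (∑' v : ↥(vertsOf g), F g (v : List ℕ) []) ∂μ

/-- `I_π(M)`: the laws of invariant (unimodular) processes `(T,X)` with colors in `M` over
the unimodular Galton-Watson tree with degree distribution `π` (of mean `dd`). -/
def IPiMeas (π : ℕ → ℝ) (dd : ℝ) (M : Type*) [MeasurableSpace M] :
    Set (Measure (RCG M)) :=
  {μ | IsProbabilityMeasure μ ∧ μ {g | IsCanonTree g} = 1 ∧ Unimodular μ ∧
    IsUGWTreeLaw π dd μ}

/-- The root degree `deg(o)` of a canonically labeled tree (the number of children of the
root). -/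
def rootDeg (g : RCG M) : ℕ := {i : ℕ | g.col [i] ≠ none}.ncard

/-- The edge-biased law `→μ(⬝) = (1/d) E[deg(o) 1{(T,X,(o,1)) ∈ ⬝}]` on colored edge-rooted
trees (the root edge being `([], [1])`). -/
def vecLaw (dd : ℝ) [MeasurableSpace M] (μ : Measure (RCG M)) : Measure (RCG M) :=
  (ENNReal.ofReal dd)⁻¹ • μ.withDensity (fun g => (rootDeg g : ℝ≥0∞))

/-- Membership in `E_r = B_{r-1}({o,1})` for a vertex of a canonically labeled tree. -/
def inErL (r : ℕ) (l : List ℕ) : Prop :=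
  l.length + 1 ≤ r ∨ (l.getLast? = some 1 ∧ l.length ≤ r)

/-- The restriction of a colored edge-rooted tree to `E_r = B_{r-1}({o,1})`. -/
def resE (r : ℕ) (g : RCG M) : RCG M where
  col l := if inErL r l then g.col l else none
  adj p := if inErL r p.1 ∧ inErL r p.2 then g.adj p else false

/-- The Shannon entropy `H(π)` of the probability mass function `π`. -/
def Hpmf (π : ℕ → ℝ) : ℝ := ∑' k : ℕ, Real.negMulLog (π k)

/-- The annealed entropy `Σ_r(μ) = H(X_{S_r}) - (d/2) H(→X_{E_r}) - H(π)` of an invariant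
process over the unimodular Galton-Watson tree. -/
def SigmaUGW (π : ℕ → ℝ) (dd : ℝ) [MeasurableSpace M] (r : ℕ) (μ : Measure (RCG M)) : ℝ :=
  shannon (μ.map (resS r)) - (dd / 2) * shannon ((vecLaw dd μ).map (resE r)) - Hpmf π

/-- `Σ(μ) = lim_{r → ∞} Σ_r(μ)` (the limit of a non-increasing sequence). -/
def SigmaUGWInf (π : ℕ → ℝ) (dd : ℝ) [MeasurableSpace M] (μ : Measure (RCG M)) : EReal :=
  ⨅ r : ℕ, ((SigmaUGW π dd (r + 1) μ : ℝ) : EReal)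

/-- `Σ_e(X) = (d/2) H(→X_{E_1}) - d H(→X_o) + H(X_o) - H(π)`. -/
def SigmaEUGW (π : ℕ → ℝ) (dd : ℝ) [MeasurableSpace M] (μ : Measure (RCG M)) : ℝ :=
  (dd / 2) * shannon ((vecLaw dd μ).map (resE 1))
    - dd * shannon ((vecLaw dd μ).map (resS 0))
    + shannon (μ.map (resS 0)) - Hpmf π

/-! ### Markov processes on random trees -/

/-- The side of the (potential) edge `{u,w}` containing `u`, among the labels. -/
def sideL (u w : List ℕ) : Set (List ℕ) := {v | treeDist v u < treeDist v w}

/-- `B_{r-1}({u,w})` among the labels. -/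
def edgeBallL (r : ℕ) (u w : List ℕ) : Set (List ℕ) :=
  {v | treeDist v u + 1 ≤ r ∨ treeDist v w + 1 ≤ r}

/-- The event that the tree structure agrees with that of `y` on `S` and that the colored
tree agrees with `y` on `B`. -/
def treeCylEvent (S B : Set (List ℕ)) (y : RCG M) : Set (RCG M) :=
  {g | (∀ l ∈ S, (g.col l ≠ none ↔ y.col l ≠ none)) ∧ (∀ l ∈ B, g.col l = y.col l)}

/-- A random colored tree is `r`-Markov on the ambient set `A` if, conditioned on the tree
and on the value on the `(r-1)`-neighborhood of an edge, the processes on the two sides of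
the edge are independent (conditioning on the tree is expressed through arbitrary finite
windows `S`). -/
def rMarkovTreeOn [MeasurableSpace M] (r : ℕ) (A : Set (List ℕ)) (μ : Measure (RCG M)) :
    Prop :=
  ∀ (u : List ℕ) (i : ℕ), 1 ≤ i → u ∈ A → (i :: u) ∈ A →
    ∀ F₁ F₂ : Finset (List ℕ), ↑F₁ ⊆ sideL u (i :: u) ∩ A → ↑F₂ ⊆ sideL (i :: u) u ∩ A →
    ∀ S : Finset (List ℕ), ↑S ⊆ A → ∀ y : RCG M,
      μ (treeCylEvent ↑S (edgeBallL r u (i :: u) ∩ A) y ∩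
          treeCylEvent ∅ ↑F₁ y ∩ treeCylEvent ∅ ↑F₂ y)
        * μ (treeCylEvent ↑S (edgeBallL r u (i :: u) ∩ A) y)
      = μ (treeCylEvent ↑S (edgeBallL r u (i :: u) ∩ A) y ∩ treeCylEvent ∅ ↑F₁ y)
        * μ (treeCylEvent ↑S (edgeBallL r u (i :: u) ∩ A) y ∩ treeCylEvent ∅ ↑F₂ y)

/-- A random colored tree is `r`-Markov if the above holds with ambient set everything. -/
def rMarkovTree [MeasurableSpace M] (r : ℕ) (μ : Measure (RCG M)) : Prop :=
  rMarkovTreeOn r Set.univ μ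

/-- A random colored tree is vertex-Markov on the ambient set `A` if, conditioned on the tree
and on the value at a vertex, the processes on the pending subtrees of that vertex are
independent. -/
def vertexMarkovTreeOn [MeasurableSpace M] (A : Set (List ℕ)) (μ : Measure (RCG M)) :
    Prop :=
  ∀ v ∈ A, ∀ (k : ℕ) (u : Fin k → List ℕ), Function.Injective u →
    (∀ j, u j ∈ A ∧ ((∃ i, 1 ≤ i ∧ u j = i :: v) ∨ (v ≠ [] ∧ u j = v.tail))) →
    ∀ F : Fin k → Finset (List ℕ), (∀ j, ↑(F j) ⊆ sideL (u j) v ∩ A) →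
    ∀ S : Finset (List ℕ), ↑S ⊆ A → ∀ y : RCG M,
      μ (treeCylEvent ↑S {v} y ∩ ⋂ j, treeCylEvent ∅ ↑(F j) y)
          * (μ (treeCylEvent ↑S {v} y)) ^ (k - 1)
        = ∏ j : Fin k, μ (treeCylEvent ↑S {v} y ∩ treeCylEvent ∅ ↑(F j) y)

/-- A random colored tree is vertex-Markov if the above holds with ambient set everything. -/
def vertexMarkovTree [MeasurableSpace M] (μ : Measure (RCG M)) : Prop :=
  vertexMarkovTreeOn Set.univ μ

/-! ### Random graphs with given degree sequences -/

/-- The set of simple graphs on `{1,…,n}` with degree sequence `dn`. -/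
def degSeqGraphs (n : ℕ) (dn : Fin n → ℕ) : Set (SimpleGraph (Fin n)) :=
  {G | ∀ v, (G.neighborSet v).ncard = dn v}

/-- The probability that a uniform random graph with degree sequence `dn` lies in `A`. -/
def PrD (n : ℕ) (dn : Fin n → ℕ) (A : Set (SimpleGraph (Fin n))) : ℝ :=
  ((degSeqGraphs n dn ∩ A).ncard : ℝ) / ((degSeqGraphs n dn).ncard : ℝ)

/-- `𝓕_G(μ,r,ε)` for a process `μ` over a unimodular Galton-Watson tree. -/
def FSetD [MeasurableSpace M] (μ : Measure (RCG M)) (r : ℕ) (ε : ℝ) {n : ℕ}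
    (G : SimpleGraph (Fin n)) : Set (Fin n → M) :=
  {f | levyProkhorovDist ((distrG G f).map (resS r)) (μ.map (resS r)) ≤ ε}

/-- `H_G(μ,r,ε) = (1/n) log |𝓕_G(μ,r,ε)|`. -/
def HGD [MeasurableSpace M] (μ : Measure (RCG M)) (r : ℕ) (ε : ℝ) {n : ℕ}
    (G : SimpleGraph (Fin n)) : EReal :=
  if FSetD μ r ε G = ∅ then ⊥
  else ((Real.log ((FSetD μ r ε G).ncard) / n : ℝ) : EReal)

/-- The `α`-quantile of `H_{G_n}(μ,r,ε)` for the uniform random graph with degree sequence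
`DN n`. -/
def hquantD [MeasurableSpace M] (DN : (n : ℕ) → Fin n → ℕ) (μ : Measure (RCG M)) (r : ℕ)
    (ε : ℝ) (α : ℝ) (n : ℕ) : EReal :=
  sSup {h : EReal | (h = ⊥ ∨ 0 ≤ h) ∧
    α ≤ PrD n (DN n) {G : SimpleGraph (Fin n) | h ≤ HGD μ r ε G}}

/-- `h̄(μ,r,α)` for the degree-sequence ensemble. -/
def hbarAD [MeasurableSpace M] (DN : (n : ℕ) → Fin n → ℕ) (μ : Measure (RCG M)) (r : ℕ)
    (α : ℝ) : EReal :=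
  ⨅ ε : {e : ℝ // 0 < e}, Filter.atTop.limsup (fun n => hquantD DN μ r ε.1 α n)

/-- `h̲(μ,r,α)` for the degree-sequence ensemble. -/
def hlowAD [MeasurableSpace M] (DN : (n : ℕ) → Fin n → ℕ) (μ : Measure (RCG M)) (r : ℕ)
    (α : ℝ) : EReal :=
  ⨅ ε : {e : ℝ // 0 < e}, Filter.atTop.liminf (fun n => hquantD DN μ r ε.1 α n)

/-- `h̄(μ,r)`: the common value of `h̄(μ,r,α)`, `0 < α < 1`. -/
def hbarRD [MeasurableSpace M] (DN : (n : ℕ) → Fin n → ℕ) (μ : Measure (RCG M)) (r : ℕ) :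
    EReal :=
  hbarAD DN μ r (1 / 2)

/-- `h̲(μ,r)`. -/
def hlowRD [MeasurableSpace M] (DN : (n : ℕ) → Fin n → ℕ) (μ : Measure (RCG M)) (r : ℕ) :
    EReal :=
  hlowAD DN μ r (1 / 2)

/-- The upper sofic entropy `h̄(μ) = lim_{r → ∞} h̄(μ,r)`. -/
def hbarD [MeasurableSpace M] (DN : (n : ℕ) → Fin n → ℕ) (μ : Measure (RCG M)) : EReal :=
  ⨅ r : ℕ, hbarRD DN μ r

/-- The lower sofic entropy `h̲(μ) = lim_{r → ∞} h̲(μ,r)`. -/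
def hlowD [MeasurableSpace M] (DN : (n : ℕ) → Fin n → ℕ) (μ : Measure (RCG M)) : EReal :=
  ⨅ r : ℕ, hlowRD DN μ r

/-- The hypotheses on the degree sequences: uniformly bounded by `Δ`, even sums, and
empirical distributions converging (weakly) to `π`. -/
def GoodDegSeq (π : ℕ → ℝ) (Δ : ℝ) (DN : (n : ℕ) → Fin n → ℕ) : Prop :=
  (∀ n v, (DN n v : ℝ) ≤ Δ) ∧ (∀ n, Even (∑ v : Fin n, DN n v)) ∧
  (∀ k : ℕ, Tendsto (fun n => (((Finset.univ.filter (fun v : Fin n => DN n v = k)).card : ℝ) / n))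
    atTop (nhds (π k)))

/-- The hypotheses on the degree distribution `π`: a probability mass function supported in
`{0,…,Δ}` with mean `dd > 0`. -/
def GoodPmf (π : ℕ → ℝ) (Δ : ℝ) (dd : ℝ) : Prop :=
  (∀ k, 0 ≤ π k) ∧ (∑' k : ℕ, π k) = 1 ∧ (∀ k : ℕ, (Δ : ℝ) < k → π k = 0) ∧
  (∑' k : ℕ, (k : ℝ) * π k) = dd ∧ 0 < dd


/-! ### Couplings -/

/-- `ν ∈ I_d(M × M)` is an invariant coupling of `μ` with itself: both coordinate marginal
processes of `ν` have law `μ`. -/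
def IsInvCoupling (d : ℕ) {M : Type*} [MeasurableSpace M] (μ : Measure (TdVertex d → M))
    (ν : Measure (TdVertex d → M × M)) : Prop :=
  ν ∈ InvMeas d (M × M) ∧ ν.map (fun x => fun v => (x v).1) = μ ∧
    ν.map (fun x => fun v => (x v).2) = μ

/-- The first coordinate marginal of a colored graph with colors in a product set. -/
def rcgFst {M₁ M₂ : Type*} (g : RCG (M₁ × M₂)) : RCG M₁ :=
  ⟨fun l => (g.col l).map Prod.fst, g.adj⟩

/-- The second coordinate marginal of a colored graph with colors in a product set. -/
def rcgSnd {M₁ M₂ : Type*} (g : RCG (M₁ × M₂)) : RCG M₂ :=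
  ⟨fun l => (g.col l).map Prod.snd, g.adj⟩

/-- `ν ∈ I_π(M × M)` is an invariant coupling of `μ ∈ I_π(M)` with itself. -/
def IsInvCouplingUGW (π : ℕ → ℝ) (dd : ℝ) {M : Type*} [MeasurableSpace M]
    (μ : Measure (RCG M)) (ν : Measure (RCG (M × M))) : Prop :=
  ν ∈ IPiMeas π dd (M × M) ∧ ν.map rcgFst = μ ∧ ν.map rcgSnd = μ


/-! ### Subadditivity of entropy for a finite star -/

section Star

variable {ι β : Type*} [Fintype ι] [DecidableEq ι] [Fintype β]

/-- The marginal at the coordinate `i` of a weight function `w` on `ι → β`. -/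
def coordMarginal (w : (ι → β) → ℝ) (i : ι) (b : β) : ℝ :=
  ∑ x with x i = b, w x

lemma coordMarginal_nonneg {w : (ι → β) → ℝ} (hw : ∀ x, 0 ≤ w x) (i : ι) (b : β) :
    0 ≤ coordMarginal w i b :=
  Finset.sum_nonneg fun x _ => hw x

lemma sum_mul_coordMarginal (w : (ι → β) → ℝ) (i : ι) (g : β → ℝ) :
    ∑ x, w x * g (x i) = ∑ b, coordMarginal w i b * g b := by
  rw [← Finset.sum_fiberwise Finset.univ (fun x : ι → β => x i)]
  refine Finset.sum_congr rfl fun b _ => ?_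
  rw [coordMarginal, Finset.sum_mul]
  refine Finset.sum_congr rfl fun x hx => ?_
  rw [(Finset.mem_filter.1 hx).2]

lemma sum_coordMarginal (w : (ι → β) → ℝ) (i : ι) :
    ∑ b, coordMarginal w i b = ∑ x, w x := by
  simpa using (sum_mul_coordMarginal w i fun _ => 1).symm

lemma le_coordMarginal {w : (ι → β) → ℝ} (hw : ∀ x, 0 ≤ w x) (i : ι) (x : ι → β) :
    w x ≤ coordMarginal w i (x i) :=
  Finset.single_le_sum (f := w) (fun y _ => hw y) (by simp)

lemma negMulLog_add_mul_log_le {w q : ℝ} (hw : 0 ≤ w) (hq : 0 ≤ q) (h : w ≠ 0 → q ≠ 0) :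
    Real.negMulLog w + w * Real.log q ≤ q - w ∧
      (Real.negMulLog w + w * Real.log q = q - w ↔ w = q) := by
  rcases hw.eq_or_lt with rfl | hw
  · simpa [eq_comm] using hq
  have hq : 0 < q := lt_of_le_of_ne hq (h hw.ne').symm
  have heq : Real.negMulLog w + w * Real.log q = w * Real.log (q / w) := by
    rw [Real.log_div hq.ne' hw.ne', Real.negMulLog]; ring
  have hsub : q - w = w * (q / w - 1) := by field_simp
  rw [heq, hsub]
  by_cases hne : q / w = 1
  · have : q = w := by rwa [div_eq_one_iff_eq hw.ne'] at hne
    simp [this, hw.ne']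
  · have hlt : w * Real.log (q / w) < w * (q / w - 1) :=
      mul_lt_mul_of_pos_left (Real.log_lt_sub_one_of_pos (div_pos hq hw) hne) hw
    refine ⟨hlt.le, fun h => absurd h hlt.ne, fun h => absurd ?_ hne⟩
    rw [h, div_self (h ▸ hw.ne')]

/-- Subadditivity of entropy for a weight function of total mass `W` on `ι → β`, with the
equality case. -/
theorem sum_negMulLog_le_sum_coordMarginal [Nonempty ι] {w : (ι → β) → ℝ}
    (hw : ∀ x, 0 ≤ w x) :
    ∑ x, Real.negMulLog (w x) ≤ ∑ i, ∑ b, Real.negMulLog (coordMarginal w i b)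
        - ((Fintype.card ι : ℝ) - 1) * Real.negMulLog (∑ x, w x) ∧
    (∑ x, Real.negMulLog (w x) = ∑ i, ∑ b, Real.negMulLog (coordMarginal w i b)
        - ((Fintype.card ι : ℝ) - 1) * Real.negMulLog (∑ x, w x) ↔
      ∀ x, w x * (∑ x, w x) ^ (Fintype.card ι - 1) = ∏ i, coordMarginal w i (x i)) := by
  set W := ∑ x, w x with hW
  have hW0 : 0 ≤ W := Finset.sum_nonneg fun x _ => hw x
  have hr := coordMarginal_nonneg hw
  have hcard : 0 < Fintype.card ι := Fintype.card_pos
  rcases hW0.eq_or_lt with h0 | hWpos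
  · have hwz : ∀ x, w x = 0 := by
      intro x
      exact (Finset.sum_eq_zero_iff_of_nonneg fun x _ => hw x).1 h0.symm x (Finset.mem_univ x)
    have hrz : ∀ i b, coordMarginal w i b = 0 := fun i b =>
      Finset.sum_eq_zero fun x _ => hwz x
    simp [hwz, hrz, ← h0, hcard.ne']
  set q : (ι → β) → ℝ := fun x => (∏ i, coordMarginal w i (x i)) / W ^ (Fintype.card ι - 1)
    with hq
  have hpow : 0 < W ^ (Fintype.card ι - 1) := pow_pos hWpos _
  have hq0 : ∀ x, 0 ≤ q x := fun x =>
    div_nonneg (Finset.prod_nonneg fun i _ => hr i _) hpow.le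
  have hrpos : ∀ x, w x ≠ 0 → ∀ i, coordMarginal w i (x i) ≠ 0 := fun x hx i =>
    ((lt_of_le_of_ne (hw x) hx.symm).trans_le (le_coordMarginal hw i x)).ne'
  have hqne : ∀ x, w x ≠ 0 → q x ≠ 0 := fun x hx =>
    div_ne_zero (Finset.prod_ne_zero_iff.2 fun i _ => hrpos x hx i) hpow.ne'
  have hsumq : ∑ x, q x = W := by
    rw [hq, ← Finset.sum_div, ← Fintype.piFinset_univ,
      ← Finset.prod_univ_sum (fun _ : ι => (Finset.univ : Finset β))
        (fun i b => coordMarginal w i b)]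
    simp_rw [sum_coordMarginal]
    rw [Finset.prod_const, Finset.card_univ, ← hW, div_eq_iff hpow.ne', ← pow_succ',
      Nat.sub_add_cancel hcard]
  have hlog : ∀ x, w x * Real.log (q x) =
      ∑ i, w x * Real.log (coordMarginal w i (x i))
        - w x * (((Fintype.card ι : ℝ) - 1) * Real.log W) := by
    intro x
    by_cases hx : w x = 0
    · simp [hx]
    · rw [hq, Real.log_div (Finset.prod_ne_zero_iff.2 fun i _ => hrpos x hx i) hpow.ne',
        Real.log_prod (fun i _ => hrpos x hx i), Real.log_pow, Nat.cast_sub hcard, mul_sub,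
        Finset.mul_sum, Nat.cast_one]
  have hsumlog : ∑ x, w x * Real.log (q x) =
      -(∑ i, ∑ b, Real.negMulLog (coordMarginal w i b)
        - ((Fintype.card ι : ℝ) - 1) * Real.negMulLog W) := by
    simp_rw [hlog]
    rw [Finset.sum_sub_distrib, Finset.sum_comm, ← Finset.sum_mul, ← hW]
    have hi : ∀ i, ∑ x, w x * Real.log (coordMarginal w i (x i)) =
        ∑ b, coordMarginal w i b * Real.log (coordMarginal w i b) := fun i =>
      sum_mul_coordMarginal w i fun b => Real.log (coordMarginal w i b)
    simp_rw [hi, Real.negMulLog, neg_mul, Finset.sum_neg_distrib]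
    ring
  have hle : ∀ x ∈ Finset.univ,
      Real.negMulLog (w x) + w x * Real.log (q x) ≤ q x - w x := fun x _ =>
    (negMulLog_add_mul_log_le (hw x) (hq0 x) (hqne x)).1
  have hsum_le := Finset.sum_le_sum hle
  have hsum_eq := Finset.sum_eq_sum_iff_of_le hle
  rw [Finset.sum_add_distrib, Finset.sum_sub_distrib, hsumq, ← hW, sub_self, hsumlog,
    add_neg_eq_zero] at hsum_eq
  rw [Finset.sum_add_distrib, Finset.sum_sub_distrib, hsumq, ← hW, sub_self, hsumlog] at hsum_le
  refine ⟨by linarith, hsum_eq.trans ?_⟩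
  simp only [Finset.mem_univ, true_implies]
  refine forall_congr' fun x => ?_
  rw [(negMulLog_add_mul_log_le (hw x) (hq0 x) (hqne x)).2, hq, eq_div_iff hpow.ne']

end Star

/-! ### Entropies of finite restrictions -/

instance (d : ℕ) : Countable (TdVertex d) :=
  inferInstanceAs (Countable {l : List ℕ // ValidTd d l})

/-- The entropy of the restriction to the range of `u`, as a finite sum. -/
lemma shannon_restrictTo_range {d : ℕ} {N κ : Type*} [Fintype N] [Fintype κ] [DecidableEq κ]
    [MeasurableSpace N] [DiscreteMeasurableSpace N] (μ : Measure (TdVertex d → N))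
    {u : κ → TdVertex d} (hu : Function.Injective u) {S : Set (TdVertex d)}
    (hS : S = Set.range u) :
    shannon (restrictTo S μ) =
      ∑ f : κ → N, Real.negMulLog (μ.real {ω | ∀ k, ω (u k) = f k}) := by
  subst hS
  let e : (κ → N) ≃ (Set.range u → N) := (Equiv.ofInjective u hu).arrowCongr (Equiv.refl N)
  rw [shannon, ← e.tsum_eq, tsum_fintype]
  refine Finset.sum_congr rfl fun f _ => ?_
  have hmeas : Measurable fun (ω : TdVertex d → N) (v : Set.range u) => ω v.1 := by fun_prop
  rw [restrictTo, Measure.map_apply hmeas (MeasurableSet.singleton _), Measure.real]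
  congr 3
  ext ω
  simp only [Set.mem_preimage, Set.mem_singleton_iff, Set.mem_ofPred_eq, funext_iff,
    (Equiv.ofInjective u hu).surjective.forall]
  simp [e]

/-! ### Permuting the neighbors of the root -/

/-- Apply `σ` to the root-side step of a breadth-first-search label. -/
def mapRootStep (σ : ℕ → ℕ) : List ℕ → List ℕ
  | [] => []
  | [a] => [σ a]
  | a :: b :: l => a :: mapRootStep σ (b :: l)

lemma mapRootStep_comp (σ τ : ℕ → ℕ) (l : List ℕ) :
    mapRootStep σ (mapRootStep τ l) = mapRootStep (σ ∘ τ) l := by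
  induction l with
  | nil => rfl
  | cons a l ih =>
    cases l with
    | nil => rfl
    | cons b l =>
      cases l with
      | nil => rfl
      | cons c l => simpa [mapRootStep] using ih

lemma mapRootStep_id (l : List ℕ) : mapRootStep id l = l := by
  induction l with
  | nil => rfl
  | cons a l ih =>
    cases l with
    | nil => rfl
    | cons b l => simp [mapRootStep, ih]

lemma dropLast_mapRootStep (σ : ℕ → ℕ) (l : List ℕ) :
    (mapRootStep σ l).dropLast = l.dropLast := by
  induction l with
  | nil => rfl
  | cons a l ih =>
    cases l with
    | nil => rfl
    | cons b l =>
      cases l with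
      | nil => rfl
      | cons c l => simpa [mapRootStep] using ih

lemma getLast?_mapRootStep (σ : ℕ → ℕ) (l : List ℕ) :
    (mapRootStep σ l).getLast? = l.getLast?.map σ := by
  induction l with
  | nil => rfl
  | cons a l ih =>
    cases l with
    | nil => rfl
    | cons b l =>
      cases l with
      | nil => rfl
      | cons c l => simpa [mapRootStep] using ih

lemma exists_mapRootStep_cons (σ : ℕ → ℕ) (i : ℕ) (l : List ℕ) :
    ∃ j, mapRootStep σ (i :: l) = j :: mapRootStep σ l := by
  cases l with
  | nil => exact ⟨σ i, rfl⟩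
  | cons b l => exact ⟨i, rfl⟩

lemma ValidTd.mapRootStep {d : ℕ} {σ : ℕ → ℕ} (hσ : ∀ i, 1 ≤ i ∧ i ≤ d → 1 ≤ σ i ∧ σ i ≤ d)
    {l : List ℕ} (hl : ValidTd d l) : ValidTd d (mapRootStep σ l) := by
  refine ⟨by rw [dropLast_mapRootStep]; exact hl.1, ?_⟩
  rw [getLast?_mapRootStep]
  intro i hi
  obtain ⟨j, hj, rfl⟩ := Option.map_eq_some_iff.1 hi
  exact hσ j (hl.2 j hj)

/-- The automorphism of `T_d` induced by an involution of the neighbors of the root. -/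
def rootStepIso {d : ℕ} {σ : ℕ → ℕ} (hσ : ∀ i, 1 ≤ i ∧ i ≤ d → 1 ≤ σ i ∧ σ i ≤ d)
    (hinv : σ ∘ σ = id) : TdGraph d ≃g TdGraph d where
  toFun v := ⟨mapRootStep σ v.1, v.2.mapRootStep hσ⟩
  invFun v := ⟨mapRootStep σ v.1, v.2.mapRootStep hσ⟩
  left_inv v := Subtype.ext <|
    (mapRootStep_comp σ σ v.1).trans (by rw [hinv, mapRootStep_id])
  right_inv v := Subtype.ext <|
    (mapRootStep_comp σ σ v.1).trans (by rw [hinv, mapRootStep_id])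
  map_rel_iff' := by
    have key : ∀ l l' : List ℕ,
        (∃ i, mapRootStep σ l' = i :: mapRootStep σ l) ↔ ∃ i, l' = i :: l := by
      intro l l'
      constructor
      · rintro ⟨i, hi⟩
        obtain ⟨j, hj⟩ := exists_mapRootStep_cons σ i (mapRootStep σ l)
        rw [← hi, mapRootStep_comp, mapRootStep_comp, hinv, mapRootStep_id, mapRootStep_id] at hj
        exact ⟨j, hj⟩
      · rintro ⟨i, rfl⟩
        exact exists_mapRootStep_cons σ i l
    intro v w
    exact or_congr (key v.1 w.1) (key w.1 v.1)

/-- The `i`-th neighbor of the root. -/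
def rootNbr (d : ℕ) (i : Finset.Icc 1 d) : TdVertex d :=
  ⟨[i.1], by simp [ValidTd, Finset.mem_Icc.1 i.2]⟩

lemma rootNbr_injective (d : ℕ) : Function.Injective (rootNbr d) := by
  intro i j h
  exact Subtype.ext (List.cons.inj (congrArg Subtype.val h)).1

lemma rootNbr_ne_rootTd {d : ℕ} (i : Finset.Icc 1 d) : rootNbr d i ≠ rootTd d := by
  intro h
  exact List.cons_ne_nil _ _ (congrArg Subtype.val h)

lemma measure_root_nbr_eq {d : ℕ} {N : Type*} [MeasurableSpace N] [DiscreteMeasurableSpace N]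
    {μ : Measure (TdVertex d → N)} (hμ : μ ∈ InvMeas d N) (i j : Finset.Icc 1 d) (a b : N) :
    μ {ω | ω (rootTd d) = a ∧ ω (rootNbr d i) = b} =
      μ {ω | ω (rootTd d) = a ∧ ω (rootNbr d j) = b} := by
  have hσ : ∀ k, 1 ≤ k ∧ k ≤ d →
      1 ≤ Equiv.swap i.1 j.1 k ∧ Equiv.swap i.1 j.1 k ≤ d := by
    have hi := Finset.mem_Icc.1 i.2
    have hj := Finset.mem_Icc.1 j.2
    intro k hk
    rw [Equiv.swap_apply_def]
    split_ifs <;> assumption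
  let φ := rootStepIso hσ (by ext k; simp)
  have hroot : φ (rootTd d) = rootTd d := rfl
  have hnbr : φ (rootNbr d i) = rootNbr d j :=
    Subtype.ext (congrArg (fun k => [k]) (Equiv.swap_apply_left i.1 j.1))
  have hmeas : Measurable fun (ω : TdVertex d → N) v => ω (φ v) := by fun_prop
  have heval : ∀ (v : TdVertex d) (c : N), MeasurableSet {ω : TdVertex d → N | ω v = c} :=
    fun v c => by
      have hv : Measurable fun ω : TdVertex d → N => ω v := measurable_pi_apply v
      exact hv (MeasurableSet.singleton c)
  have hset : MeasurableSet {ω : TdVertex d → N | ω (rootTd d) = a ∧ ω (rootNbr d i) = b} :=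
    (heval _ a).inter (heval _ b)
  conv_lhs => rw [← hμ.2 φ, Measure.map_apply hmeas hset]
  simp only [Set.preimage_ofPred_eq, hroot, hnbr]

/-! ### The star around the root -/

/-- The root together with a family of its neighbors. -/
def starVertex {d : ℕ} {κ : Type*} (n : κ → Finset.Icc 1 d) (o : Option κ) : TdVertex d :=
  o.elim (rootTd d) fun k => rootNbr d (n k)

lemma starVertex_injective {d : ℕ} {κ : Type*} {n : κ → Finset.Icc 1 d}
    (hn : Function.Injective n) : Function.Injective (starVertex n) := by
  rintro (_ | k) (_ | l) h
  · rfl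
  · exact absurd h.symm (rootNbr_ne_rootTd _)
  · exact absurd h (rootNbr_ne_rootTd _)
  · exact congrArg some (hn (rootNbr_injective d h))

lemma SrSet_one_eq_range (d : ℕ) :
    SrSet d 1 = Set.range (starVertex (id : Finset.Icc 1 d → _)) := by
  ext v
  constructor
  · obtain ⟨l, hl⟩ := v
    intro h
    have hlen : l.length ≤ 1 := h
    rcases l with _ | ⟨a, l⟩
    · exact ⟨none, rfl⟩
    · obtain rfl : l = [] := by simpa using hlen
      exact ⟨some ⟨a, Finset.mem_Icc.2 (hl.2 a (by simp))⟩, rfl⟩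
  · rintro ⟨_ | k, rfl⟩
    · exact Nat.zero_le 1
    · exact le_rfl (a := 1)

lemma ErSet_one_eq_range {d : ℕ} (i : Finset.Icc 1 d) (hi : i.1 = 1) :
    ErSet d 1 = Set.range (starVertex fun _ : Unit => i) := by
  ext v
  constructor
  · obtain ⟨l, hl⟩ := v
    intro h
    have hmem : l.length + 1 ≤ 1 ∨ (l.getLast? = some 1 ∧ l.length ≤ 1) := h
    rcases l with _ | ⟨a, l⟩
    · exact ⟨none, rfl⟩
    · obtain ⟨hlast, rfl⟩ : (a :: l).getLast? = some 1 ∧ l = [] := by simpa using hmem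
      obtain rfl : a = 1 := by simpa using hlast
      exact ⟨some (), Subtype.ext (congrArg (fun k => [k]) hi)⟩
  · rintro ⟨_ | k, rfl⟩
    · exact Or.inl le_rfl
    · exact Or.inr ⟨congrArg some hi, le_rfl⟩

lemma shannon_star {d : ℕ} {N κ : Type*} [Fintype N] [Fintype κ] [DecidableEq κ]
    [MeasurableSpace N] [DiscreteMeasurableSpace N] (μ : Measure (TdVertex d → N))
    {n : κ → Finset.Icc 1 d} (hn : Function.Injective n) {S : Set (TdVertex d)}
    (hS : S = Set.range (starVertex n)) :
    shannon (restrictTo S μ) = ∑ a : N, ∑ x : κ → N, Real.negMulLog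
      (μ.real {ω | ω (rootTd d) = a ∧ ∀ k, ω (rootNbr d (n k)) = x k}) := by
  rw [shannon_restrictTo_range μ (starVertex_injective hn) hS,
    ← (Equiv.piOptionEquivProd (β := fun _ : Option κ => N)).symm.sum_comp,
    Fintype.sum_prod_type]
  simp [Option.forall, starVertex]

lemma shannon_edge {d : ℕ} {N : Type*} [Fintype N]
    [MeasurableSpace N] [DiscreteMeasurableSpace N] (μ : Measure (TdVertex d → N))
    (i : Finset.Icc 1 d) (hi : i.1 = 1) :
    shannon (restrictTo (ErSet d 1) μ) = ∑ a : N, ∑ b : N, Real.negMulLog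
      (μ.real {ω | ω (rootTd d) = a ∧ ω (rootNbr d i) = b}) := by
  rw [shannon_star μ (Function.injective_of_subsingleton _) (ErSet_one_eq_range i hi)]
  refine Finset.sum_congr rfl fun a _ => ?_
  rw [← (Equiv.funUnique Unit N).symm.sum_comp]
  simp

lemma shannon_root {d : ℕ} {N : Type*} [Fintype N]
    [MeasurableSpace N] [DiscreteMeasurableSpace N] (μ : Measure (TdVertex d → N)) :
    shannon (restrictTo ({rootTd d} : Set (TdVertex d)) μ) =
      ∑ a : N, Real.negMulLog (μ.real {ω | ω (rootTd d) = a}) := by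
  rw [shannon_restrictTo_range μ (u := fun _ : Unit => rootTd d)
      (Function.injective_of_subsingleton _) (by simp),
    ← (Equiv.funUnique Unit N).symm.sum_comp]
  simp

section StarLaw

variable {d : ℕ} {N : Type*} [MeasurableSpace N] (μ : Measure (TdVertex d → N))

/-- The joint law of the values at the root and at its neighbors. -/
def starLaw (a : N) (x : Finset.Icc 1 d → N) : ℝ :=
  μ.real {ω | ω (rootTd d) = a ∧ ∀ i, ω (rootNbr d i) = x i}

variable [Fintype N] [DiscreteMeasurableSpace N] [IsFiniteMeasure μ]

lemma sum_starLaw_filter (P : (Finset.Icc 1 d → N) → Prop) [DecidablePred P] (a : N) :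
    ∑ x with P x, starLaw μ a x =
      μ.real {ω | ω (rootTd d) = a ∧ P fun i => ω (rootNbr d i)} := by
  let F : (TdVertex d → N) → N × (Finset.Icc 1 d → N) :=
    fun ω => (ω (rootTd d), fun i => ω (rootNbr d i))
  have hF : Measurable F := by fun_prop
  have h := sum_measureReal_preimage_singleton (μ := μ) (f := F)
    ((Finset.univ.filter P).map ⟨Prod.mk a, Prod.mk_right_injective a⟩)
    (fun y _ => hF (MeasurableSet.singleton y))
  rw [Finset.sum_map] at h
  convert h using 2 with x _
  · rw [starLaw]
    congr 1
    ext ω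
    simp [F, Prod.ext_iff, funext_iff]
  · ext ω
    simp only [F, Set.mem_preimage, Set.mem_ofPred_eq, Finset.mem_coe, Finset.mem_map,
      Finset.mem_filter, Finset.mem_univ, true_and, Function.Embedding.coeFn_mk, Prod.mk.injEq]
    constructor
    · rintro ⟨h, hP⟩
      exact ⟨_, hP, h.symm, rfl⟩
    · rintro ⟨x, hP, h, rfl⟩
      exact ⟨h.symm, hP⟩

lemma sum_starLaw (a : N) : ∑ x, starLaw μ a x = μ.real {ω | ω (rootTd d) = a} := by
  simpa using sum_starLaw_filter μ (fun _ => True) a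

lemma coordMarginal_starLaw (a : N) (i : Finset.Icc 1 d) (b : N) :
    coordMarginal (starLaw μ a) i b =
      μ.real {ω | ω (rootTd d) = a ∧ ω (rootNbr d i) = b} :=
  sum_starLaw_filter μ (fun x => x i = b) a

lemma vertexMarkovOnS1_iff_starLaw :
    vertexMarkovOnS1 d μ ↔ ∀ a x, starLaw μ a x * (∑ x, starLaw μ a x) ^ (d - 1) =
      ∏ i, coordMarginal (starLaw μ a) i (x i) := by
  simp_rw [sum_starLaw, coordMarginal_starLaw]
  have hS1 : ∀ y : TdVertex d → N, cylEvent (SrSet d 1) y =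
      {ω | ω (rootTd d) = y (rootTd d) ∧ ∀ i, ω (rootNbr d i) = y (rootNbr d i)} := by
    intro y
    ext ω
    rw [SrSet_one_eq_range]
    exact Set.forall_mem_range.trans Option.forall
  have hroot : ∀ y : TdVertex d → N, cylEvent ({rootTd d} : Set (TdVertex d)) y =
      {ω | ω (rootTd d) = y (rootTd d)} := by
    intro y
    simp [cylEvent]
  have hedge : ∀ (y : TdVertex d → N) (i : Finset.Icc 1 d),
      cylEvent {v : TdVertex d | v = rootTd d ∨ v.1 = [i.1]} y =
      {ω | ω (rootTd d) = y (rootTd d) ∧ ω (rootNbr d i) = y (rootNbr d i)} := by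
    intro y i
    have : ∀ v : TdVertex d, v.1 = [i.1] ↔ v = rootNbr d i := fun v =>
      ⟨fun h => Subtype.ext h, fun h => congrArg Subtype.val h⟩
    ext ω
    simp [cylEvent, this]
  have key : ∀ y : TdVertex d → N,
      (μ (cylEvent (SrSet d 1) y) *
          (μ (cylEvent ({rootTd d} : Set (TdVertex d)) y)) ^ (d - 1)
        = ∏ i ∈ Finset.Icc 1 d, μ (cylEvent {v : TdVertex d | v = rootTd d ∨ v.1 = [i]} y)) ↔
      starLaw μ (y (rootTd d)) (fun i => y (rootNbr d i)) *
          μ.real {ω | ω (rootTd d) = y (rootTd d)} ^ (d - 1) =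
        ∏ i, μ.real {ω | ω (rootTd d) = y (rootTd d) ∧
          ω (rootNbr d i) = y (rootNbr d i)} := by
    intro y
    rw [← Finset.prod_coe_sort, ← ENNReal.toReal_eq_toReal_iff'
      (ENNReal.mul_ne_top (measure_ne_top _ _) (ENNReal.pow_ne_top (measure_ne_top _ _)))
      (ENNReal.prod_ne_top fun _ _ => measure_ne_top _ _)]
    simp_rw [hS1, hroot, hedge, ENNReal.toReal_mul, ENNReal.toReal_pow, ENNReal.toReal_prod]
    rfl
  unfold vertexMarkovOnS1
  simp_rw [key]
  refine ⟨fun h a x => ?_, fun h y => h _ _⟩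
  let y : TdVertex d → N := fun v =>
    if hv : ∃ i, rootNbr d i = v then x hv.choose else a
  have hy : ∀ i, y (rootNbr d i) = x i := by
    intro i
    have hv : ∃ j, rootNbr d j = rootNbr d i := ⟨i, rfl⟩
    simp only [y, dif_pos hv]
    exact congrArg x (rootNbr_injective d hv.choose_spec)
  have hy0 : y (rootTd d) = a :=
    dif_neg fun ⟨i, hi⟩ => rootNbr_ne_rootTd i hi
  simpa only [hy, hy0] using h y

end StarLaw

/-- For every invariant process `X` with law in `I_d(M)`,
`Σ_1(X) ≤ Σ_e(X)`, where `Σ_1(X) = H(X_{S_1}) - (d/2) H(X_{E_1})` and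
`Σ_e(X) = (d/2) H(X_{E_1}) - (d-1) H(X_o)`, with equality iff the restriction of `X` to the
ball `S_1` is a vertex-Markov process on `S_1` (the values at the `d` neighbors of the root
are conditionally independent given the value at the root). -/
theorem Sigma1_le_SigmaE_iff_vertexMarkov
    (d : ℕ) (hd : 3 ≤ d) (M : Type) [Fintype M] [MeasurableSpace M]
    [DiscreteMeasurableSpace M]
    (μ : Measure (TdVertex d → M)) (hμ : μ ∈ InvMeas d M) :
    SigmaR d 1 μ ≤ SigmaE d μ ∧
    (SigmaR d 1 μ = SigmaE d μ ↔ vertexMarkovOnS1 d μ) := by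
  have hprob : IsProbabilityMeasure μ := hμ.1
  let i₁ : Finset.Icc 1 d := ⟨1, Finset.mem_Icc.2 ⟨le_rfl, by omega⟩⟩
  have : Nonempty (Finset.Icc 1 d) := ⟨i₁⟩
  have hcard : Fintype.card (Finset.Icc 1 d) = d := by simp
  have hstar : ∀ a, _ := fun a =>
    sum_negMulLog_le_sum_coordMarginal (w := starLaw μ a) fun x => measureReal_nonneg
  rw [hcard] at hstar
  have hle := Finset.sum_le_sum fun a (_ : a ∈ Finset.univ) => (hstar a).1
  have heq := Finset.sum_eq_sum_iff_of_le fun a (_ : a ∈ Finset.univ) => (hstar a).1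
  have hball : shannon (restrictTo (SrSet d 1) μ) =
      ∑ a, ∑ x, Real.negMulLog (starLaw μ a x) :=
    shannon_star μ Function.injective_id (SrSet_one_eq_range d)
  have hedges : ∑ a, (∑ i, ∑ b, Real.negMulLog (coordMarginal (starLaw μ a) i b)
      - ((d : ℝ) - 1) * Real.negMulLog (∑ x, starLaw μ a x)) =
      d * shannon (restrictTo (ErSet d 1) μ)
        - ((d : ℝ) - 1) * shannon (restrictTo ({rootTd d} : Set (TdVertex d)) μ) := by
    have hinv : ∀ a b i, coordMarginal (starLaw μ a) i b =
        μ.real {ω | ω (rootTd d) = a ∧ ω (rootNbr d i₁) = b} := fun a b i => by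
      rw [coordMarginal_starLaw, Measure.real, measure_root_nbr_eq hμ i i₁, Measure.real]
    simp_rw [hinv, sum_starLaw]
    rw [shannon_edge μ i₁ rfl, shannon_root, Finset.sum_sub_distrib, Finset.mul_sum,
      Finset.mul_sum]
    simp
  rw [← hball, hedges] at hle heq
  simp only [Finset.mem_univ, true_implies] at heq
  unfold SigmaR SigmaE
  refine ⟨by linarith, ?_⟩
  rw [vertexMarkovOnS1_iff_starLaw, ← forall_congr' fun a => (hstar a).2, ← heq]
  constructor <;> intro h <;> linarith

end TreeEntropy
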